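/- There is a computable function F : ℚ × ℚ × ℚ × ℚ × ℚ × ℚ → Bool such that for all rationals a1, b1, a2, b2, c, x0: if the two-interval PAM f defined by a1, b1, a2, b2, c maps [0,1) ∩ ℚ into [0,1) ∩ ℚ, is injective on [0,1) ∩ ℚ, and x0 ∈ [0,1) ∩ ℚ, then F (a1, b1, a2, b2, c, x0) = true if and only if there exist n, m : ℕ with n < m and f^[n] x0 = f^[m] x0. (The periodic orbit problem is decidable for injective two-interval PAM.) -/

import Mathlib

/-- The two-interval piecewise affine map on `[0,1) ∩ ℚ` given by rationals
`a1, b1, a2, b2, c`. -/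
def pam2 (a1 b1 a2 b2 c : ℚ) (x : ℚ) : ℚ :=
  if 0 ≤ x ∧ x < c then a1 * x + b1
  else if c ≤ x ∧ x < 1 then a2 * x + b2
  else 0

def prank (P : Finset ℚ) (x : ℚ) : ℤ := ((P.filter (fun w => w < x)).card : ℤ)

theorem prank_nonneg (P : Finset ℚ) (x : ℚ) : 0 ≤ prank P x := by
  unfold prank; positivity

theorem prank_lt (P : Finset ℚ) (x : ℚ) (hx : x ∈ P) : prank P x < P.card := by
  unfold prank
  have : (P.filter (fun w => w < x)).card < P.card := by
    apply Finset.card_lt_card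
    refine ⟨Finset.filter_subset _ _, fun h => ?_⟩
    have := h hx
    simp at this
  exact_mod_cast this

theorem prank_inj (P : Finset ℚ) (x y : ℚ) (hx : x ∈ P) (hy : y ∈ P)
    (h : prank P x = prank P y) : x = y := by
  have key : ∀ x y : ℚ, x ∈ P → x < y → prank P x < prank P y := by
    intro x y hx hxy
    unfold prank
    have : (P.filter (fun w => w < x)).card < (P.filter (fun w => w < y)).card := by
      apply Finset.card_lt_card
      refine ⟨?_, fun h => ?_⟩
      · intro w hw
        simp only [Finset.mem_filter] at hw ⊢
        exact ⟨hw.1, hw.2.trans hxy⟩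
      · have := h (Finset.mem_filter.2 ⟨hx, hxy⟩)
        simp at this
    exact_mod_cast this
  rcases lt_trichotomy x y with hl | hl | hl
  · have := key x y hx hl; omega
  · exact hl
  · have := key y x hy hl; omega

theorem prank_surj (P : Finset ℚ) (i : ℤ) (h0 : 0 ≤ i) (h1 : i < P.card) :
    ∃ x ∈ P, prank P x = i := by
  have hsub : P.image (prank P) ⊆ Finset.Ico (0 : ℤ) P.card := by
    intro z hz
    obtain ⟨x, hx, rfl⟩ := Finset.mem_image.1 hz
    exact Finset.mem_Ico.2 ⟨prank_nonneg P x, prank_lt P x hx⟩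
  have hcard : (P.image (prank P)).card = P.card :=
    Finset.card_image_of_injOn (fun x hx y hy h => prank_inj P x y hx hy h)
  have heq := Finset.eq_of_subset_of_card_le hsub (by rw [hcard]; simp)
  have : i ∈ P.image (prank P) := by rw [heq]; exact Finset.mem_Ico.2 ⟨h0, h1⟩
  obtain ⟨x, hx, h⟩ := Finset.mem_image.1 this
  exact ⟨x, hx, h⟩

/-- the complementary rank: number of elements above. -/
theorem prank_compl (P : Finset ℚ) (x : ℚ) (hx : x ∈ P) :
    ((P.filter (fun w => x < w)).card : ℤ) = P.card - 1 - prank P x := by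
  unfold prank
  have h1 : (P.filter (fun w => w < x)).card + (P.filter (fun w => ¬ w < x)).card = P.card :=
    Finset.card_filter_add_card_filter_not (s := P) _
  have h2 : P.filter (fun w => ¬ w < x) = insert x (P.filter (fun w => x < w)) := by
    ext w
    simp only [Finset.mem_filter, Finset.mem_insert, not_lt]
    constructor
    · rintro ⟨h, h'⟩
      rcases h'.eq_or_lt with h'' | h''
      · left; exact h''.symm
      · right; exact ⟨h, h''⟩
    · rintro (rfl | ⟨h, h'⟩)
      · exact ⟨hx, le_rfl⟩
      · exact ⟨h, h'.le⟩
  have h3 : x ∉ P.filter (fun w => x < w) := by simp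
  rw [h2, Finset.card_insert_of_notMem h3] at h1
  omega

theorem prank_image (f : ℚ → ℚ) (P : Finset ℚ) (hmap : ∀ x ∈ P, f x ∈ P)
    (hinj : Set.InjOn f P) (x : ℚ) :
    prank P (f x) = ((P.filter (fun w => f w < f x)).card : ℤ) := by
  unfold prank
  have himg : P.image f = P := by
    apply Finset.eq_of_subset_of_card_le
    · intro z hz
      obtain ⟨w, hw, rfl⟩ := Finset.mem_image.1 hz
      exact hmap w hw
    · rw [Finset.card_image_of_injOn hinj]
  have : P.filter (fun w => w < f x) = (P.filter (fun w => f w < f x)).image f := by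
    conv_lhs => rw [← himg]
    rw [Finset.filter_image]
  rw [this, Finset.card_image_of_injOn]
  intro a ha b hb h
  simp only [Finset.coe_filter, Set.mem_ofPred_eq] at ha hb
  exact hinj ha.1 hb.1 h

/-- number of orbit points to the right of `c` -/
def rcnt (P : Finset ℚ) (c : ℚ) : ℤ := ((P.filter (fun w => c ≤ w)).card : ℤ)

theorem card_split (P : Finset ℚ) (c : ℚ) :
    ((P.filter (fun w => w < c)).card : ℤ) + rcnt P c = P.card := by
  have h1 : (P.filter (fun w => w < c)).card + (P.filter (fun w => ¬ w < c)).card = P.card :=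
    Finset.card_filter_add_card_filter_not (s := P) _
  simp only [not_lt] at h1
  unfold rcnt
  exact_mod_cast h1

theorem prank_left_iff (P : Finset ℚ) (c x : ℚ) (hx : x ∈ P) :
    c ≤ x ↔ (P.card : ℤ) - rcnt P c ≤ prank P x := by
  have hs := card_split P c
  constructor
  · intro h
    have : (P.filter (fun w => w < c)).card ≤ (P.filter (fun w => w < x)).card := by
      apply Finset.card_le_card
      intro w hw
      simp only [Finset.mem_filter] at hw ⊢
      exact ⟨hw.1, hw.2.trans_le h⟩
    unfold prank
    omega
  · intro h
    by_contra hc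
    push Not at hc
    have : (P.filter (fun w => w < x)).card < (P.filter (fun w => w < c)).card := by
      apply Finset.card_lt_card
      refine ⟨?_, fun h => ?_⟩
      · intro w hw
        simp only [Finset.mem_filter] at hw ⊢
        exact ⟨hw.1, hw.2.trans hc⟩
      · have := h (Finset.mem_filter.2 ⟨hx, hc⟩)
        simp at this
    unfold prank at h
    omega

theorem card_disj_union (P : Finset ℚ) (p r s : ℚ → Prop) [DecidablePred p] [DecidablePred r]
    [DecidablePred s] (h : ∀ w ∈ P, p w ↔ r w ∨ s w) (hd : ∀ w ∈ P, r w → ¬ s w) :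
    ((P.filter p).card : ℤ) = (P.filter r).card + (P.filter s).card := by
  have : P.filter p = P.filter r ∪ P.filter s := by
    ext w
    simp only [Finset.mem_filter, Finset.mem_union]
    constructor
    · rintro ⟨a, b⟩
      rcases (h w a).1 b with h | h
      · left; exact ⟨a, h⟩
      · right; exact ⟨a, h⟩
    · rintro (⟨a, b⟩ | ⟨a, b⟩)
      · exact ⟨a, (h w a).2 (Or.inl b)⟩
      · exact ⟨a, (h w a).2 (Or.inr b)⟩
  rw [this, Finset.card_union_of_disjoint]
  · push_cast; rfl
  · rw [Finset.disjoint_filter]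
    exact hd

/-- The flip lemma. -/
theorem flip_potential (f : ℚ → ℚ) (P : Finset ℚ) (hmap : ∀ x ∈ P, f x ∈ P)
    (htrans : ∀ Q : ℚ → Prop, (∀ x ∈ P, Q x → Q (f x)) → (∃ z ∈ P, Q z) → ∀ y ∈ P, Q y)
    (φ : ℚ → ℤ) (q l : ℤ) (hl0 : 0 ≤ l) (hlq : l ≤ q)
    (hr : ∀ x ∈ P, 0 ≤ φ x ∧ φ x < q)
    (hφinj : ∀ x ∈ P, ∀ y ∈ P, φ x = φ y → x = y)
    (hsurj : ∀ i, 0 ≤ i → i < q → ∃ x ∈ P, φ x = i)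
    (A : ℚ → Prop) (hA : ∀ x ∈ P, A x ↔ q - l ≤ φ x)
    (h1 : ∀ x ∈ P, ¬ A x → φ (f x) = φ x + l)
    (h2 : ∀ x ∈ P, A x → φ (f x) = q - 1 - φ x) :
    ∃ ψ : ℚ → ℤ, (∀ x ∈ P, 0 ≤ ψ x ∧ ψ x < q) ∧
      (∀ x ∈ P, ¬ A x → ψ (f x) = ψ x + l) ∧ (∀ x ∈ P, A x → ψ (f x) = ψ x + l - q) ∧
      (∀ x ∈ P, ∀ y ∈ P, ∀ z ∈ P, ψ x = ψ y → ψ y = ψ z → x = y ∨ y = z ∨ x = z) := by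
  have hinv : ∀ y ∈ P, (l ∣ φ y ∨ l ∣ (q - 1 - φ y)) := by
    by_cases hq : 0 < q
    · apply htrans
      · intro x hx hQ
        by_cases hAx : A x
        · rw [h2 x hx hAx]
          rcases hQ with h | h
          · right
            have e : q - 1 - (q - 1 - φ x) = φ x := by omega
            rw [e]; exact h
          · left; exact h
        · rw [h1 x hx hAx]
          rcases hQ with h | h
          · left; exact dvd_add h dvd_rfl
          · right
            have := dvd_sub h (dvd_refl l)
            have e : q - 1 - (φ x + l) = q - 1 - φ x - l := by ring
            rw [e]; exact this
      · obtain ⟨z, hz, h⟩ := hsurj 0 le_rfl hq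
        exact ⟨z, hz, Or.inl (by rw [h]; exact dvd_zero _)⟩
    · intro y hy
      have := hr y hy
      omega
  have hl2 : l ≤ 2 := by
    by_contra hcon
    push Not at hcon
    obtain ⟨y, hy, h⟩ := hsurj 1 (by norm_num) (by omega)
    obtain ⟨z, hz, h'⟩ := hsurj 2 (by norm_num) (by omega)
    have e1 := hinv y hy
    have e2 := hinv z hz
    rw [h] at e1
    rw [h'] at e2
    have n1 : ¬ l ∣ 1 := fun h => by have := Int.le_of_dvd (by norm_num) h; omega
    have n2 : ¬ l ∣ 2 := fun h => by have := Int.le_of_dvd (by norm_num) h; omega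
    have e1' := e1.resolve_left n1
    have e2' := e2.resolve_left n2
    apply n1
    have := dvd_sub e1' e2'
    have e : q - 1 - 1 - (q - 1 - 2) = 1 := by ring
    rw [e] at this; exact this
  by_cases hl1 : l ≤ 1
  · refine ⟨φ, hr, h1, ?_, ?_⟩
    · intro x hx hAx
      rw [h2 x hx hAx]
      have := (hA x hx).1 hAx
      have := hr x hx
      omega
    · intro x hx y hy z hz h _
      left; exact hφinj x hx y hy h
  · have hl : l = 2 := by omega
    subst hl
    have hq2 : q % 2 = 0 := by
      obtain ⟨y, hy, h⟩ := hsurj 1 (by norm_num) (by omega)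
      have e1 := hinv y hy
      rw [h] at e1
      omega
    refine ⟨fun x => 2 * (φ x / 2), ?_, ?_, ?_, ?_⟩
    · intro x hx
      have := hr x hx
      constructor <;> simp only <;> omega
    · intro x hx hAx
      simp only [h1 x hx hAx]
      omega
    · intro x hx hAx
      simp only [h2 x hx hAx]
      have := (hA x hx).1 hAx
      have := hr x hx
      omega
    · intro x hx y hy z hz e1 e2
      simp only at e1 e2
      have : φ x = φ y ∨ φ y = φ z ∨ φ x = φ z := by omega
      rcases this with h | h | h
      · left; exact hφinj x hx y hy h
      · right; left; exact hφinj y hy z hz h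
      · right; right; exact hφinj x hx z hz h

/-- Combinatorial structure of periodic orbits. -/
theorem orbit_potential (f : ℚ → ℚ) (P : Finset ℚ) (c : ℚ) (hmap : ∀ x ∈ P, f x ∈ P)
    (hinj : Set.InjOn f P)
    (htrans : ∀ Q : ℚ → Prop, (∀ x ∈ P, Q x → Q (f x)) → (∃ z ∈ P, Q z) → ∀ y ∈ P, Q y)
    (hm1 : (∀ x ∈ P, ∀ y ∈ P, x < c → y < c → (f x < f y ↔ x < y)) ∨
      (∀ x ∈ P, ∀ y ∈ P, x < c → y < c → (f x < f y ↔ y < x)))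
    (hm2 : (∀ x ∈ P, ∀ y ∈ P, c ≤ x → c ≤ y → (f x < f y ↔ x < y)) ∨
      (∀ x ∈ P, ∀ y ∈ P, c ≤ x → c ≤ y → (f x < f y ↔ y < x)))
    (ho : (∀ x ∈ P, ∀ y ∈ P, x < c → c ≤ y → f x < f y) ∨
      (∀ x ∈ P, ∀ y ∈ P, x < c → c ≤ y → f y < f x)) :
    (∀ x ∈ P, f (f x) = x) ∨
    ∃ ψ : ℚ → ℤ, (∀ x ∈ P, 0 ≤ ψ x ∧ ψ x < P.card) ∧
      (∀ x ∈ P, x < c → ψ (f x) = ψ x + rcnt P c) ∧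
      (∀ x ∈ P, c ≤ x → ψ (f x) = ψ x + rcnt P c - P.card) ∧
      (∀ x ∈ P, ∀ y ∈ P, ∀ z ∈ P, ψ x = ψ y → ψ y = ψ z → x = y ∨ y = z ∨ x = z) := by
  have hs := card_split P c
  have hl0 : 0 ≤ rcnt P c := by unfold rcnt; positivity
  rcases ho with ho | ho
  · left
    -- order 12
    have fixed_of : ∀ x ∈ P, prank P (f x) = prank P x → f x = x := fun x hx h =>
      prank_inj P _ _ (hmap x hx) hx h
    have L1 : ∀ x ∈ P, x < c → prank P (f x) = prank P x ∨
        prank P (f x) = P.card - rcnt P c - 1 - prank P x := by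
      intro x hx hxc
      rw [prank_image f P hmap hinj]
      rcases hm1 with hm | hm
      · left
        unfold prank
        congr 2
        apply Finset.filter_congr
        intro w hw
        by_cases hwc : w < c
        · exact hm w hw x hx hwc hxc
        · push Not at hwc
          have := ho x hx w hw hxc hwc
          constructor
          · intro h; exact absurd h this.not_gt
          · intro h; exact absurd h (hxc.trans_le hwc).not_gt
      · right
        have h1 := prank_compl P x hx
        have h2 := card_disj_union P (fun w => x < w) (fun w => f w < f x) (fun w => c ≤ w) (by
          intro w hw
          by_cases hwc : w < c
          · rw [hm w hw x hx hwc hxc]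
            constructor
            · intro h; exact Or.inl h
            · rintro (h | h)
              · exact h
              · exact absurd h hwc.not_ge
          · push Not at hwc
            constructor
            · intro h; exact Or.inr hwc
            · intro h; exact hxc.trans_le hwc) (by
          intro w hw h hwc
          exact absurd h (ho x hx w hw hxc hwc).not_gt)
        unfold rcnt at *
        omega
    have L2 : ∀ x ∈ P, c ≤ x → prank P (f x) = prank P x ∨
        prank P (f x) = P.card - rcnt P c + (P.card - 1 - prank P x) := by
      intro x hx hxc
      rw [prank_image f P hmap hinj]
      rcases hm2 with hm | hm
      · left
        unfold prank
        congr 2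
        apply Finset.filter_congr
        intro w hw
        by_cases hwc : w < c
        · have := ho w hw x hx hwc hxc
          exact ⟨fun _ => hwc.trans_le hxc, fun _ => this⟩
        · push Not at hwc
          exact hm w hw x hx hwc hxc
      · right
        have h1 := prank_compl P x hx
        have h2 := card_disj_union P (fun w => f w < f x) (fun w => x < w) (fun w => w < c) (by
          intro w hw
          by_cases hwc : w < c
          · exact ⟨fun _ => Or.inr hwc, fun _ => ho w hw x hx hwc hxc⟩
          · rw [hm w hw x hx (not_lt.1 hwc) hxc]
            exact ⟨fun h => Or.inl h, fun h => h.resolve_right hwc⟩) (by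
          intro w hw h hwc
          exact absurd (h.trans hwc) hxc.not_gt)
        omega
    intro x hx
    have hfx := hmap x hx
    have hffx := hmap _ hfx
    have hr0 := prank_nonneg P x
    have hr1 := prank_lt P x hx
    by_cases hxc : x < c
    · rcases L1 x hx hxc with h | h
      · have h' := fixed_of x hx h
        rw [h', h']
      · have hxr := (prank_left_iff P c x hx).not.1 (not_le.2 hxc)
        have hfc : f x < c := by
          rw [← not_le, prank_left_iff P c (f x) hfx]
          omega
        rcases L1 (f x) hfx hfc with h' | h'
        · have h'' := fixed_of (f x) hfx h'
          have : f x = x := hinj hfx hx h''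
          rw [this, this]
        · apply prank_inj P _ _ hffx hx
          omega
    · push Not at hxc
      rcases L2 x hx hxc with h | h
      · have h' := fixed_of x hx h
        rw [h', h']
      · have hxr := (prank_left_iff P c x hx).1 hxc
        have hfc : c ≤ f x := by
          rw [prank_left_iff P c (f x) hfx]
          omega
        rcases L2 (f x) hfx hfc with h' | h'
        · have h'' := fixed_of (f x) hfx h'
          have : f x = x := hinj hfx hx h''
          rw [this, this]
        · apply prank_inj P _ _ hffx hx
          omega
  · -- order 21
    have L1p : (∀ x ∈ P, ∀ y ∈ P, x < c → y < c → (f x < f y ↔ x < y)) →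
        ∀ x ∈ P, x < c → prank P (f x) = prank P x + rcnt P c := by
      intro hm x hx hxc
      rw [prank_image f P hmap hinj]
      apply card_disj_union
      · intro w hw
        by_cases hwc : w < c
        · rw [hm w hw x hx hwc hxc]
          exact ⟨fun h => Or.inl h, fun h => h.resolve_right hwc.not_ge⟩
        · push Not at hwc
          exact ⟨fun h => Or.inr hwc, fun _ => ho x hx w hw hxc hwc⟩
      · intro w hw h hwc
        exact absurd (hwc.trans_lt h) hxc.not_gt
    have L1n : (∀ x ∈ P, ∀ y ∈ P, x < c → y < c → (f x < f y ↔ y < x)) →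
        ∀ x ∈ P, x < c → prank P (f x) = P.card - 1 - prank P x := by
      intro hm x hx hxc
      rw [prank_image f P hmap hinj, ← prank_compl P x hx]
      congr 2
      apply Finset.filter_congr
      intro w hw
      by_cases hwc : w < c
      · exact hm w hw x hx hwc hxc
      · push Not at hwc
        exact ⟨fun _ => hxc.trans_le hwc, fun _ => ho x hx w hw hxc hwc⟩
    have L2p : (∀ x ∈ P, ∀ y ∈ P, c ≤ x → c ≤ y → (f x < f y ↔ x < y)) →
        ∀ x ∈ P, c ≤ x → prank P (f x) = prank P x + rcnt P c - P.card := by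
      intro hm x hx hxc
      rw [prank_image f P hmap hinj]
      have h2 := card_disj_union P (fun w => w < x) (fun w => f w < f x) (fun w => w < c) (by
        intro w hw
        by_cases hwc : w < c
        · exact ⟨fun _ => Or.inr hwc, fun _ => hwc.trans_le hxc⟩
        · rw [hm w hw x hx (not_lt.1 hwc) hxc]
          exact ⟨fun h => Or.inl h, fun h => h.resolve_right hwc⟩) (by
        intro w hw h hwc
        exact absurd h (ho w hw x hx hwc hxc).not_gt)
      unfold prank
      omega
    have L2n : (∀ x ∈ P, ∀ y ∈ P, c ≤ x → c ≤ y → (f x < f y ↔ y < x)) →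
        ∀ x ∈ P, c ≤ x → prank P (f x) = P.card - 1 - prank P x := by
      intro hm x hx hxc
      rw [prank_image f P hmap hinj, ← prank_compl P x hx]
      congr 2
      apply Finset.filter_congr
      intro w hw
      by_cases hwc : w < c
      · constructor
        · intro h; exact absurd h (ho w hw x hx hwc hxc).not_gt
        · intro h; exact absurd h (hwc.trans_le hxc).not_gt
      · exact hm w hw x hx (not_lt.1 hwc) hxc
    rcases hm1 with hm1 | hm1 <;> rcases hm2 with hm2 | hm2
    · right
      refine ⟨prank P, fun x hx => ⟨prank_nonneg P x, prank_lt P x hx⟩, L1p hm1, L2p hm2, ?_⟩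
      intro x hx y hy z hz h _
      left; exact prank_inj P x y hx hy h
    · right
      obtain ⟨ψ, h1, h2, h3, h4⟩ := flip_potential f P hmap htrans (prank P) P.card (rcnt P c) hl0
        (by omega) (fun x hx => ⟨prank_nonneg P x, prank_lt P x hx⟩)
        (fun x hx y hy h => prank_inj P x y hx hy h) (prank_surj P) (fun x => c ≤ x)
        (fun x hx => prank_left_iff P c x hx)
        (fun x hx h => L1p hm1 x hx (not_le.1 h)) (L2n hm2)
      exact ⟨ψ, h1, fun x hx h => h2 x hx (not_le.2 h), h3, h4⟩
    · right
      obtain ⟨ψ, h1, h2, h3, h4⟩ := flip_potential f P hmap htrans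
        (fun x => P.card - 1 - prank P x) P.card (P.card - rcnt P c)
        (by omega)
        (by omega) (fun x hx => by
          have := prank_nonneg P x
          have := prank_lt P x hx
          constructor <;> omega)
        (fun x hx y hy h => prank_inj P x y hx hy (by omega))
        (fun i hi hi' => by
          obtain ⟨x, hx, h⟩ := prank_surj P (P.card - 1 - i) (by omega) (by omega)
          exact ⟨x, hx, by omega⟩) (fun x => x < c)
        (fun x hx => by
          have := prank_left_iff P c x hx
          rw [← not_le, this]
          constructor <;> intro h <;> omega)
        (fun x hx h => by
          have := L2p hm2 x hx (not_lt.1 h)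
          omega)
        (fun x hx h => by
          have := L1n hm1 x hx h
          omega)
      refine ⟨fun x => P.card - 1 - ψ x, ?_, ?_, ?_, ?_⟩
      · intro x hx
        have := h1 x hx
        constructor <;> simp only <;> omega
      · intro x hx h
        have := h3 x hx h
        simp only; omega
      · intro x hx h
        have := h2 x hx (not_lt.2 h)
        simp only; omega
      · intro x hx y hy z hz e1 e2
        simp only at e1 e2
        exact h4 x hx y hy z hz (by omega) (by omega)
    · left
      intro x hx
      have H : ∀ x ∈ P, prank P (f x) = P.card - 1 - prank P x := by
        intro x hx
        by_cases hxc : x < c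
        · exact L1n hm1 x hx hxc
        · exact L2n hm2 x hx (not_lt.1 hxc)
      apply prank_inj P _ _ (hmap _ (hmap x hx)) hx
      rw [H _ (hmap x hx), H x hx]
      ring

theorem val_step (p : ℕ) [Fact p.Prime] (s t : ℚ) (g : ℤ) (hg : 0 ≤ g)
    (ht : -g ≤ padicValRat p t) (hs : padicValRat p s < -g) :
    padicValRat p (s + t) = padicValRat p s := by
  by_cases ht0 : t = 0
  · rw [ht0, add_zero]
  have hs0 : s ≠ 0 := by
    rintro rfl
    rw [padicValRat.zero] at hs
    omega
  have hst : s + t ≠ 0 := by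
    intro h
    have : s = -t := by linarith
    rw [this, padicValRat.neg] at hs
    omega
  exact padicValRat.add_eq_of_lt hst hs0 ht0 (by omega)

theorem val_add_ge (p : ℕ) [Fact p.Prime] (s t : ℚ) (g : ℤ) (hg : 0 ≤ g)
    (ht : -g ≤ padicValRat p t) (hs : -g ≤ padicValRat p s) :
    -g ≤ padicValRat p (s + t) := by
  by_cases h : s + t = 0
  · rw [h, padicValRat.zero]; omega
  · exact (le_min hs ht).trans (padicValRat.min_le_padicValRat_add h)

theorem pot_bound (q ψ W S : ℤ) (h0 : 0 ≤ ψ) (h1 : ψ < q) (hW1 : -S ≤ W) (hW2 : W ≤ S) :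
    -(q * S) ≤ ψ * W ∧ ψ * W ≤ q * S := by
  have hS : 0 ≤ S := by omega
  constructor <;> nlinarith

/-- Expanding/contracting case: valuations bounded below along the orbit. -/
theorem padic_bound (p : ℕ) [Fact p.Prime] (f : ℚ → ℚ) (P : Finset ℚ)
    (a1 b1 a2 b2 c : ℚ) (ha1 : a1 ≠ 0) (ha2 : a2 ≠ 0)
    (hf1 : ∀ x ∈ P, x < c → f x = a1 * x + b1)
    (hf2 : ∀ x ∈ P, c ≤ x → f x = a2 * x + b2)
    (hmap : ∀ x ∈ P, f x ∈ P) (hsurj : ∀ y ∈ P, ∃ x ∈ P, f x = y)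
    (q l : ℤ) (ψ : ℚ → ℤ) (hψ : ∀ x ∈ P, 0 ≤ ψ x ∧ ψ x < q)
    (h1 : ∀ x ∈ P, x < c → ψ (f x) = ψ x + l)
    (h2 : ∀ x ∈ P, c ≤ x → ψ (f x) = ψ x + l - q)
    (g : ℤ) (hg : 0 ≤ g) (hb1 : -g ≤ padicValRat p b1) (hb2 : -g ≤ padicValRat p b2)
    (S : ℤ) (hS : S = |padicValRat p a1| + |padicValRat p a2|)
    (hΛ : (q - l) * padicValRat p a1 + l * padicValRat p a2 ≠ 0) :
    ∀ x ∈ P, -(g + 3 * S) ≤ padicValRat p x := by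
  set V1 := padicValRat p a1 with hV1
  set V2 := padicValRat p a2 with hV2
  have hS0 : 0 ≤ S := by rw [hS]; positivity
  have hV1S : -S ≤ V1 ∧ V1 ≤ S := by
    have := abs_le.1 (le_refl |V1|); have := abs_nonneg V2; constructor <;> linarith
  have hV2S : -S ≤ V2 ∧ V2 ≤ S := by
    have := abs_le.1 (le_refl |V2|); have := abs_nonneg V1; constructor <;> linarith
  have hWS : -S ≤ V2 - V1 ∧ V2 - V1 ≤ S := by
    have := abs_le.1 (le_refl |V2|); have := abs_le.1 (le_refl |V1|); constructor <;> linarith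
  set u : ℚ → ℤ := fun x => q * padicValRat p x + ψ x * (V2 - V1) with hu
  set Λ := (q - l) * V1 + l * V2 with hLam
  -- one-step relation
  have step : ∀ x ∈ P, (padicValRat p x < -(g + S) ∨ padicValRat p (f x) < -(g + S)) →
      u (f x) = u x + Λ := by
    have gen : ∀ x a b : ℚ, a ≠ 0 → -S ≤ padicValRat p a → padicValRat p a ≤ S →
        -g ≤ padicValRat p b →
        (padicValRat p x < -(g + S) ∨ padicValRat p (a * x + b) < -(g + S)) →
        padicValRat p (a * x + b) = padicValRat p a + padicValRat p x := by
      intro x a b ha hl hu hb hx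
      have hmul : x ≠ 0 → padicValRat p (a * x) = padicValRat p a + padicValRat p x :=
        fun hx0 => padicValRat.mul ha hx0
      rcases hx with hx | hx
      · have hx0 : x ≠ 0 := by
          rintro rfl
          rw [padicValRat.zero] at hx; omega
        rw [val_step p (a * x) b g hg hb (by rw [hmul hx0]; omega), hmul hx0]
      · have h3 := val_step p (a * x + b) (-b) g hg (by rw [padicValRat.neg]; exact hb) (by omega)
        have e : a * x + b + -b = a * x := by ring
        rw [e] at h3
        have hx0 : x ≠ 0 := by
          rintro rfl
          rw [mul_zero, padicValRat.zero] at h3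
          rw [mul_zero] at hx
          omega
        rw [← h3, hmul hx0]
    intro x hx hlow
    by_cases hxc : x < c
    · have e := gen x a1 b1 ha1 hV1S.1 hV1S.2 hb1 (by rw [← hf1 x hx hxc]; exact hlow)
      simp only [hu]
      rw [h1 x hx hxc, hf1 x hx hxc, e]
      simp only [hLam, ← hV1]
      ring
    · push Not at hxc
      have e := gen x a2 b2 ha2 hV2S.1 hV2S.2 hb2 (by rw [← hf2 x hx hxc]; exact hlow)
      simp only [hu]
      rw [h2 x hx hxc, hf2 x hx hxc, e]
      simp only [hLam, ← hV2]
      ring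
  intro x hx
  obtain ⟨m, hm, hmin⟩ := Finset.exists_min_image P u ⟨x, hx⟩
  have hmlow : -(g + S) ≤ padicValRat p m := by
    by_contra hcon
    push Not at hcon
    rcases lt_or_gt_of_ne hΛ with hneg | hpos
    · have := step m hm (Or.inl hcon)
      have := hmin (f m) (hmap m hm)
      omega
    · obtain ⟨y, hy, rfl⟩ := hsurj m hm
      have := step y hy (Or.inr hcon)
      have := hmin y hy
      omega
  have hq : 0 < q := by have := hψ x hx; omega
  have hux := hmin x hx
  have hbm := pot_bound q (ψ m) (V2 - V1) S (hψ m hm).1 (hψ m hm).2 hWS.1 hWS.2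
  have hbx := pot_bound q (ψ x) (V2 - V1) S (hψ x hx).1 (hψ x hx).2 hWS.1 hWS.2
  simp only [hu] at hux
  have : q * -(g + S) ≤ q * padicValRat p m := mul_le_mul_of_nonneg_left hmlow hq.le
  have h5 : q * (-(g + 3 * S)) ≤ q * padicValRat p x := by nlinarith
  exact le_of_mul_le_mul_left h5 hq

/-- Neutral case: explicit period. -/
theorem neutral_period (f : ℚ → ℚ) (P : Finset ℚ) (c : ℚ)
    (hmap : ∀ x ∈ P, f x ∈ P) (hinj : Set.InjOn f P)
    (q l : ℤ) (hl0 : 0 ≤ l) (hlq : l ≤ q) (ψ : ℚ → ℤ) (hψ : ∀ x ∈ P, 0 ≤ ψ x ∧ ψ x < q)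
    (h1 : ∀ x ∈ P, x < c → ψ (f x) = ψ x + l)
    (h2 : ∀ x ∈ P, c ≤ x → ψ (f x) = ψ x + l - q)
    (h3 : ∀ x ∈ P, ∀ y ∈ P, ∀ z ∈ P, ψ x = ψ y → ψ y = ψ z → x = y ∨ y = z ∨ x = z)
    (V1 V2 : ℤ) (hΛ : (q - l) * V1 + l * V2 = 0) :
    ∀ x ∈ P, f^[2 * (V1.natAbs + V2.natAbs)] x = x := by
  have hiter : ∀ n : ℕ, ∀ x ∈ P, f^[n] x ∈ P := by
    intro n
    induction n with
    | zero => intro x hx; exact hx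
    | succ n ih => intro x hx; rw [Function.iterate_succ_apply]; exact ih _ (hmap x hx)
  have hpot : ∀ n : ℕ, ∀ x ∈ P, ∃ t : ℤ, ψ (f^[n] x) = ψ x + n * l - t * q := by
    intro n
    induction n with
    | zero => intro x hx; exact ⟨0, by simp⟩
    | succ n ih =>
      intro x hx
      obtain ⟨t, ht⟩ := ih x hx
      rw [Function.iterate_succ_apply']
      by_cases hc : f^[n] x < c
      · refine ⟨t, ?_⟩
        rw [h1 _ (hiter n x hx) hc, ht]; push_cast; ring
      · refine ⟨t + 1, ?_⟩
        rw [h2 _ (hiter n x hx) (not_lt.1 hc), ht]; push_cast; ring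
  set m := V1.natAbs + V2.natAbs with hm
  have hml : (m : ℤ) * l = |V1| * q := by
    have e1 : (q - l) * |V1| = l * |V2| := by
      have : (q - l) * V1 = -(l * V2) := by linarith
      have := congrArg abs this
      rw [abs_neg, abs_mul, abs_mul, abs_of_nonneg hl0, abs_of_nonneg (by omega : 0 ≤ q - l)] at this
      exact this
    rw [hm]; push_cast
    linarith
  have hinvm : ∀ x ∈ P, ψ (f^[m] x) = ψ x := by
    intro x hx
    obtain ⟨t, ht⟩ := hpot m x hx
    have hx1 := hψ x hx
    have hx2 := hψ _ (hiter m x hx)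
    rw [hml] at ht
    have e : ψ (f^[m] x) - ψ x = (|V1| - t) * q := by rw [ht]; ring
    have hq : 0 < q := by omega
    have : |V1| - t = 0 := by
      by_contra hne
      rcases lt_or_gt_of_ne hne with h | h
      · have : (|V1| - t) * q ≤ -1 * q := mul_le_mul_of_nonneg_right (by omega) hq.le
        omega
      · have : 1 * q ≤ (|V1| - t) * q := mul_le_mul_of_nonneg_right (by omega) hq.le
        omega
    rw [this] at e
    omega
  intro x hx
  have hy := hiter m x hx
  have hz := hiter m _ hy
  have e2 : f^[2 * m] x = f^[m] (f^[m] x) := by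
    rw [two_mul, Function.iterate_add_apply]
  rw [e2]
  have hinjm : ∀ n : ℕ, ∀ x ∈ P, ∀ y ∈ P, f^[n] x = f^[n] y → x = y := by
    intro n
    induction n with
    | zero => intro x _ y _ h; exact h
    | succ n ih =>
      intro x hx y hy h
      rw [Function.iterate_succ_apply, Function.iterate_succ_apply] at h
      exact hinj hx hy (ih _ (hmap x hx) _ (hmap y hy) h)
  rcases h3 x hx _ hy _ hz (hinvm x hx).symm (hinvm _ hy).symm with h | h | h
  · rw [← h, ← h]
  · have := hinjm m x hx _ hy h
    rw [← this, ← this]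
  · exact h.symm

theorem val_ge_den (p : ℕ) (b : ℚ) : -(padicValNat p b.den : ℤ) ≤ padicValRat p b := by
  rw [padicValRat_def]
  have : (0 : ℤ) ≤ (padicValInt p b.num : ℤ) := by positivity
  omega

theorem den_val_le (p : ℕ) [hp : Fact p.Prime] (x : ℚ) (w : ℕ) (h : -(w : ℤ) ≤ padicValRat p x) :
    padicValNat p x.den ≤ w := by
  by_cases hd : p ∣ x.den
  · have hn : ¬ (p : ℤ) ∣ x.num := by
      intro hn
      have h1 : p ∣ x.num.natAbs := Int.natCast_dvd.1 hn
      have := Nat.dvd_gcd h1 hd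
      rw [x.reduced] at this
      exact hp.1.one_lt.ne' (Nat.dvd_one.1 this)
    have e := padicValRat_def p x
    rw [padicValInt.eq_zero_of_not_dvd hn] at e
    omega
  · rw [padicValNat.eq_zero_of_not_dvd hd]; omega

theorem abs_val_le (p : ℕ) (a : ℚ) :
    |padicValRat p a| ≤ padicValNat p a.num.natAbs + padicValNat p a.den := by
  rw [padicValRat_def, padicValInt]
  rw [abs_le]
  constructor <;> omega

theorem card_le_of_den_dvd (P : Finset ℚ) (G : ℕ) (hG : G ≠ 0)
    (hP : ∀ x ∈ P, 0 ≤ x ∧ x < 1) (hd : ∀ x ∈ P, x.den ∣ G) : P.card ≤ G := by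
  have key : ∀ x ∈ P, ∃ k : ℕ, k < G ∧ x * G = k := by
    intro x hx
    obtain ⟨e, he⟩ := hd x hx
    have hx0 := (hP x hx).1
    have hGpos : (0 : ℚ) < G := by exact_mod_cast Nat.pos_of_ne_zero hG
    have hxG : x * G = ((x.num.toNat * e : ℕ) : ℚ) := by
      have hn : ((x.num.toNat : ℕ) : ℚ) = (x.num : ℚ) := by
        have := Int.toNat_of_nonneg (Rat.num_nonneg.2 hx0)
        exact_mod_cast congrArg (fun z : ℤ => (z : ℚ)) this
      have hxd : x * x.den = x.num := Rat.mul_den_eq_num x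
      push_cast
      rw [hn, he, ← hxd]
      push_cast
      ring
    refine ⟨x.num.toNat * e, ?_, hxG⟩
    have : ((x.num.toNat * e : ℕ) : ℚ) < G := by
      rw [← hxG]
      have := mul_lt_mul_of_pos_right (hP x hx).2 hGpos
      linarith
    exact_mod_cast this
  choose! k hk using key
  have : P.card ≤ (Finset.range G).card := by
    apply Finset.card_le_card_of_injOn k
    · intro x hx
      exact Finset.mem_coe.2 (Finset.mem_range.2 (hk x hx).1)
    · intro x hx y hy h
      have e1 := (hk x hx).2
      have e2 := (hk y hy).2
      rw [h, ← e2] at e1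
      have hGpos : (G : ℚ) ≠ 0 := by exact_mod_cast hG
      exact mul_right_cancel₀ hGpos e1
  simpa using this

def pamE (a1 a2 : ℚ) : ℕ := a1.num.natAbs * a1.den * (a2.num.natAbs * a2.den)

def pamG (a1 b1 a2 b2 x0 : ℚ) : ℕ := b1.den * b2.den * x0.den * pamE a1 a2 ^ 3

theorem pam_left (a1 b1 a2 b2 c x : ℚ) (h0 : 0 ≤ x) (h : x < c) :
    pam2 a1 b1 a2 b2 c x = a1 * x + b1 := by
  unfold pam2; rw [if_pos ⟨h0, h⟩]

theorem pam_right (a1 b1 a2 b2 c x : ℚ) (h : c ≤ x) (h1 : x < 1) :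
    pam2 a1 b1 a2 b2 c x = a2 * x + b2 := by
  unfold pam2; rw [if_neg (fun hh => absurd hh.2 h.not_gt), if_pos ⟨h, h1⟩]

theorem pam_iter_mem (f : ℚ → ℚ) (hmaps : ∀ x ∈ Set.Ico (0 : ℚ) 1, f x ∈ Set.Ico (0 : ℚ) 1)
    (x0 : ℚ) (hx0 : x0 ∈ Set.Ico (0 : ℚ) 1) (n : ℕ) : f^[n] x0 ∈ Set.Ico (0 : ℚ) 1 := by
  induction n with
  | zero => exact hx0
  | succ n ih => rw [Function.iterate_succ_apply']; exact hmaps _ ih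

theorem pam_slopes_ne (a1 b1 a2 b2 c : ℚ) (hc0 : 0 < c) (hc1 : c < 1)
    (hinj : Set.InjOn (pam2 a1 b1 a2 b2 c) (Set.Ico (0 : ℚ) 1)) : a1 ≠ 0 ∧ a2 ≠ 0 := by
  constructor
  · rintro rfl
    have e : pam2 0 b1 a2 b2 c 0 = pam2 0 b1 a2 b2 c (c / 2) := by
      rw [pam_left _ _ _ _ _ _ le_rfl hc0, pam_left _ _ _ _ _ _ (by linarith) (by linarith)]; ring
    have := hinj ⟨le_rfl, by norm_num⟩ ⟨by linarith, by linarith⟩ e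
    linarith
  · rintro rfl
    have e : pam2 a1 b1 0 b2 c c = pam2 a1 b1 0 b2 c ((c + 1) / 2) := by
      rw [pam_right _ _ _ _ _ _ le_rfl hc1, pam_right _ _ _ _ _ _ (by linarith) (by linarith)]; ring
    have := hinj ⟨by linarith, by linarith⟩ ⟨by linarith, by linarith⟩ e
    linarith

theorem pam_order (a1 b1 a2 b2 c : ℚ) (hc0 : 0 < c) (hc1 : c < 1)
    (hinj : Set.InjOn (pam2 a1 b1 a2 b2 c) (Set.Ico (0 : ℚ) 1)) :
    (∀ x y, 0 ≤ x → x < c → c ≤ y → y < 1 → a1 * x + b1 < a2 * y + b2) ∨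
    (∀ x y, 0 ≤ x → x < c → c ≤ y → y < 1 → a2 * y + b2 < a1 * x + b1) := by
  have hne : ∀ x y, 0 ≤ x → x < c → c ≤ y → y < 1 → a1 * x + b1 ≠ a2 * y + b2 := by
    intro x y h0 h1 h2 h3 e
    have mx : x ∈ Set.Ico (0 : ℚ) 1 := ⟨h0, by linarith⟩
    have my : y ∈ Set.Ico (0 : ℚ) 1 := ⟨by linarith, h3⟩
    have : x = y := hinj mx my (by
      rw [pam_left _ _ _ _ _ _ h0 h1, pam_right _ _ _ _ _ _ h2 h3, e])
    linarith
  by_contra hcon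
  push Not at hcon
  obtain ⟨⟨x, y, hx0, hx1, hy0, hy1, h⟩, ⟨x', y', hx0', hx1', hy0', hy1', h'⟩⟩ := hcon
  have h := lt_of_le_of_ne h (hne x y hx0 hx1 hy0 hy1).symm
  have h' := lt_of_le_of_ne h' (hne x' y' hx0' hx1' hy0' hy1')
  set d := a1 * x + b1 - (a2 * y + b2) with hd
  set d' := a2 * y' + b2 - (a1 * x' + b1) with hd'
  have hdp : 0 < d := by linarith
  have hdp' : 0 < d' := by linarith
  have hs : 0 < d + d' := by linarith
  set t := d / (d + d') with ht
  have ht0 : 0 < t := div_pos hdp hs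
  have ht1 : t < 1 := (div_lt_one hs).2 (by linarith)
  have htm : t * (d + d') = d := div_mul_cancel₀ d hs.ne'
  apply hne ((1 - t) * x + t * x') ((1 - t) * y + t * y')
  · nlinarith
  · nlinarith
  · nlinarith
  · nlinarith
  · have : a1 * ((1 - t) * x + t * x') + b1 - (a2 * ((1 - t) * y + t * y') + b2)
        = d - t * (d + d') := by rw [hd, hd']; ring
    rw [htm] at this
    linarith

theorem val_E (p : ℕ) [Fact p.Prime] (a1 a2 : ℚ) (h1 : a1 ≠ 0) (h2 : a2 ≠ 0) :
    |padicValRat p a1| + |padicValRat p a2| ≤ padicValNat p (pamE a1 a2) := by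
  have n1 : a1.num.natAbs ≠ 0 := Int.natAbs_ne_zero.2 (Rat.num_ne_zero.2 h1)
  have n2 : a2.num.natAbs ≠ 0 := Int.natAbs_ne_zero.2 (Rat.num_ne_zero.2 h2)
  have d1 := a1.den_nz
  have d2 := a2.den_nz
  unfold pamE
  rw [padicValNat.mul (mul_ne_zero n1 d1) (mul_ne_zero n2 d2), padicValNat.mul n1 d1,
    padicValNat.mul n2 d2]
  have := abs_val_le p a1
  have := abs_val_le p a2
  simp only [Nat.cast_add] at *
  linarith

theorem pam_period_bound (a1 b1 a2 b2 c x0 : ℚ) (hc0 : 0 < c) (hc1 : c < 1)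
    (hmaps : ∀ x ∈ Set.Ico (0 : ℚ) 1, pam2 a1 b1 a2 b2 c x ∈ Set.Ico (0 : ℚ) 1)
    (hinj : Set.InjOn (pam2 a1 b1 a2 b2 c) (Set.Ico (0 : ℚ) 1))
    (hx0 : x0 ∈ Set.Ico (0 : ℚ) 1)
    (t : ℕ) (ht : 0 < t) (hper : (pam2 a1 b1 a2 b2 c)^[t] x0 = x0) :
    ∃ s, s < 2 * pamG a1 b1 a2 b2 x0 ∧ (pam2 a1 b1 a2 b2 c)^[s + 1] x0 = x0 := by
  set f := pam2 a1 b1 a2 b2 c with hf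
  obtain ⟨ha1, ha2⟩ := pam_slopes_ne a1 b1 a2 b2 c hc0 hc1 hinj
  have n1 : a1.num.natAbs ≠ 0 := Int.natAbs_ne_zero.2 (Rat.num_ne_zero.2 ha1)
  have n2 : a2.num.natAbs ≠ 0 := Int.natAbs_ne_zero.2 (Rat.num_ne_zero.2 ha2)
  have hE : pamE a1 a2 ≠ 0 :=
    mul_ne_zero (mul_ne_zero n1 a1.den_nz) (mul_ne_zero n2 a2.den_nz)
  have hG : pamG a1 b1 a2 b2 x0 ≠ 0 :=
    mul_ne_zero (mul_ne_zero (mul_ne_zero b1.den_nz b2.den_nz) x0.den_nz) (pow_ne_zero _ hE)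
  set G := pamG a1 b1 a2 b2 x0 with hGdef
  suffices hs : ∃ s, 0 < s ∧ s ≤ 2 * G ∧ f^[s] x0 = x0 by
    obtain ⟨s, h1, h2, h3⟩ := hs
    refine ⟨s - 1, by omega, ?_⟩
    rw [Nat.sub_add_cancel h1]; exact h3
  have hpt : Function.IsPeriodicPt f t x0 := hper
  set q := Function.minimalPeriod f x0 with hq
  have hq0 : 0 < q := hpt.minimalPeriod_pos ht
  have hqper : f^[q] x0 = x0 := Function.iterate_minimalPeriod
  have hit : ∀ n, f^[n] x0 ∈ Set.Ico (0 : ℚ) 1 := pam_iter_mem f hmaps x0 hx0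
  set P : Finset ℚ := (Finset.range q).image (fun n => f^[n] x0) with hP
  have hmem : ∀ n, f^[n] x0 ∈ P := by
    intro n
    rw [hP, Finset.mem_image]
    exact ⟨n % q, Finset.mem_range.2 (Nat.mod_lt _ hq0), Function.iterate_mod_minimalPeriod_eq⟩
  have hPform : ∀ x ∈ P, ∃ n, n < q ∧ f^[n] x0 = x := by
    intro x hx
    rw [hP, Finset.mem_image] at hx
    obtain ⟨n, hn, h⟩ := hx
    exact ⟨n, Finset.mem_range.1 hn, h⟩
  have hcard : P.card = q := by
    rw [hP, Finset.card_image_of_injOn, Finset.card_range]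
    intro m hm n hn h
    simp only [Finset.coe_range, Set.mem_Iio] at hm hn
    exact Function.iterate_injOn_Iio_minimalPeriod hm hn h
  have hPI : ∀ x ∈ P, x ∈ Set.Ico (0 : ℚ) 1 := by
    intro x hx
    obtain ⟨n, _, rfl⟩ := hPform x hx
    exact hit n
  have hmap : ∀ x ∈ P, f x ∈ P := by
    intro x hx
    obtain ⟨n, _, rfl⟩ := hPform x hx
    rw [← Function.iterate_succ_apply' f]
    exact hmem _
  have hinjP : Set.InjOn f P := fun x hx y hy h =>
    hinj (hPI x hx) (hPI y hy) h
  have hsurj : ∀ y ∈ P, ∃ x ∈ P, f x = y := by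
    intro y hy
    obtain ⟨n, _, rfl⟩ := hPform y hy
    refine ⟨f^[n + q - 1] x0, hmem _, ?_⟩
    rw [← Function.iterate_succ_apply' f, Nat.succ_eq_add_one,
      Nat.sub_add_cancel (by omega), Function.iterate_add_apply, hqper]
  have htrans : ∀ Q : ℚ → Prop, (∀ x ∈ P, Q x → Q (f x)) → (∃ z ∈ P, Q z) → ∀ y ∈ P, Q y := by
    rintro Q hQ ⟨z, hz, hQz⟩ y hy
    obtain ⟨i, hi, rfl⟩ := hPform z hz
    obtain ⟨j, hj, rfl⟩ := hPform y hy
    have : ∀ n, Q (f^[n + i] x0) := by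
      intro n
      induction n with
      | zero => simpa using hQz
      | succ n ih =>
        rw [Nat.succ_add, Function.iterate_succ_apply']
        exact hQ _ (hmem _) ih
    have h := this (j + q - i)
    rw [Nat.sub_add_cancel (by omega), Function.iterate_add_apply, hqper] at h
    exact h
  have hf1 : ∀ x ∈ P, x < c → f x = a1 * x + b1 := fun x hx h =>
    pam_left _ _ _ _ _ _ (hPI x hx).1 h
  have hf2 : ∀ x ∈ P, c ≤ x → f x = a2 * x + b2 := fun x hx h =>
    pam_right _ _ _ _ _ _ h (hPI x hx).2
  have hcomb := orbit_potential f P c hmap hinjP htrans (by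
      rcases lt_or_gt_of_ne ha1 with h | h
      · right
        intro x hx y hy hxc hyc
        rw [hf1 x hx hxc, hf1 y hy hyc]
        constructor
        · intro h'; nlinarith
        · intro h'; nlinarith
      · left
        intro x hx y hy hxc hyc
        rw [hf1 x hx hxc, hf1 y hy hyc]
        constructor
        · intro h'; nlinarith
        · intro h'; nlinarith) (by
      rcases lt_or_gt_of_ne ha2 with h | h
      · right
        intro x hx y hy hxc hyc
        rw [hf2 x hx hxc, hf2 y hy hyc]
        constructor
        · intro h'; nlinarith
        · intro h'; nlinarith
      · left
        intro x hx y hy hxc hyc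
        rw [hf2 x hx hxc, hf2 y hy hyc]
        constructor
        · intro h'; nlinarith
        · intro h'; nlinarith) (by
      rcases pam_order a1 b1 a2 b2 c hc0 hc1 hinj with h | h
      · left
        intro x hx y hy hxc hyc
        rw [hf1 x hx hxc, hf2 y hy hyc]
        exact h x y (hPI x hx).1 hxc hyc (hPI y hy).2
      · right
        intro x hx y hy hxc hyc
        rw [hf1 x hx hxc, hf2 y hy hyc]
        exact h x y (hPI x hx).1 hxc hyc (hPI y hy).2)
  have hx0P : x0 ∈ P := hmem 0
  rcases hcomb with h2 | ⟨ψ, hψ, h1, h2, h3⟩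
  · exact ⟨2, by norm_num, by omega, h2 x0 hx0P⟩
  have hs := card_split P c
  have hl0 : 0 ≤ rcnt P c := by unfold rcnt; positivity
  by_cases hneu : ∃ p : ℕ, p.Prime ∧ (padicValRat p a1 ≠ 0 ∨ padicValRat p a2 ≠ 0) ∧
      ((P.card : ℤ) - rcnt P c) * padicValRat p a1 + rcnt P c * padicValRat p a2 = 0
  · obtain ⟨p, hp, hV, hΛ⟩ := hneu
    have : Fact p.Prime := ⟨hp⟩
    refine ⟨_, ?_, ?_, neutral_period f P c hmap hinjP P.card (rcnt P c) hl0 (by omega) ψ hψ h1 h2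
      h3 _ _ hΛ x0 hx0P⟩
    · omega
    · have e1 := val_E p a1 a2 ha1 ha2
      have e2 : padicValNat p (pamE a1 a2) ≤ pamE a1 a2 :=
        (padicValNat_le_nat_log _).trans (Nat.log_le_self _ _)
      have e3 : pamE a1 a2 ≤ G := by
        have : pamE a1 a2 ∣ G := by
          rw [hGdef]; unfold pamG
          exact Dvd.dvd.mul_left (dvd_pow_self _ (by norm_num)) _
        exact Nat.le_of_dvd (Nat.pos_of_ne_zero hG) this
      have : (padicValRat p a1).natAbs + (padicValRat p a2).natAbs ≤ padicValNat p (pamE a1 a2) := by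
        rw [Int.abs_eq_natAbs, Int.abs_eq_natAbs] at e1
        omega
      omega
  · push Not at hneu
    refine ⟨q, hq0, ?_, hqper⟩
    have : P.card ≤ G := by
      apply card_le_of_den_dvd P G hG (fun x hx => hPI x hx)
      intro x hx
      rw [← Nat.factorization_prime_le_iff_dvd x.den_nz hG]
      intro p hp
      have : Fact p.Prime := ⟨hp⟩
      rw [Nat.factorization_def _ hp, Nat.factorization_def _ hp]
      have hGv : padicValNat p G = padicValNat p b1.den + padicValNat p b2.den +
          padicValNat p x0.den + 3 * padicValNat p (pamE a1 a2) := by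
        rw [hGdef]; unfold pamG
        rw [padicValNat.mul (mul_ne_zero (mul_ne_zero b1.den_nz b2.den_nz) x0.den_nz)
          (pow_ne_zero _ hE), padicValNat.mul (mul_ne_zero b1.den_nz b2.den_nz) x0.den_nz,
          padicValNat.mul b1.den_nz b2.den_nz, padicValNat.pow]
      apply den_val_le
      have hb1 := val_ge_den p b1
      have hb2 := val_ge_den p b2
      have hbx := val_ge_den p x0
      have eE := val_E p a1 a2 ha1 ha2
      by_cases hV : padicValRat p a1 ≠ 0 ∨ padicValRat p a2 ≠ 0
      · have := padic_bound p f P a1 b1 a2 b2 c ha1 ha2 hf1 hf2 hmap hsurj P.card (rcnt P c) ψ hψ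
          h1 h2 (padicValNat p b1.den + padicValNat p b2.den) (by positivity) (by omega) (by omega)
          _ rfl (hneu p hp hV) x hx
        rw [hGv]
        omega
      · push Not at hV
        have main : ∀ n, -((padicValNat p b1.den + padicValNat p b2.den +
            padicValNat p x0.den : ℕ) : ℤ) ≤ padicValRat p (f^[n] x0) := by
          have gen : ∀ a y : ℚ, padicValRat p a = 0 → a ≠ 0 →
              -((padicValNat p b1.den + padicValNat p b2.den +
            padicValNat p x0.den : ℕ) : ℤ) ≤ padicValRat p y →
              -((padicValNat p b1.den + padicValNat p b2.den +
            padicValNat p x0.den : ℕ) : ℤ) ≤ padicValRat p (a * y) := by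
            intro a y h0 ha hy
            by_cases hy0 : y = 0
            · rw [hy0, mul_zero, padicValRat.zero]; omega
            · rw [padicValRat.mul ha hy0, h0, zero_add]; exact hy
          intro n
          induction n with
          | zero => simp only [Function.iterate_zero, id]; omega
          | succ n ih =>
            rw [Function.iterate_succ_apply']
            by_cases hc : f^[n] x0 < c
            · rw [hf1 _ (hmem n) hc]
              exact val_add_ge p _ _ _ (by positivity) (by omega) (gen _ _ hV.1 ha1 ih)
            · rw [hf2 _ (hmem n) (not_lt.1 hc)]
              exact val_add_ge p _ _ _ (by positivity) (by omega) (gen _ _ hV.2 ha2 ih)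
        obtain ⟨n, _, rfl⟩ := hPform x hx
        have := main n
        rw [hGv]
        omega
    omega

/-- The raw code of a rational. -/
def rawQ (q : ℚ) : ℕ := @Encodable.encode ℚ Rat.instEncodable q

theorem rawQ_eq (q : ℚ) : rawQ q = Nat.pair (Equiv.intEquivNat q.num) q.den := rfl

theorem intEquiv_natAbs (z : ℤ) : z.natAbs = (Equiv.intEquivNat z + 1) / 2 := by
  cases z with
  | ofNat n =>
    have : Equiv.intEquivNat (Int.ofNat n) = 2 * n := rfl
    rw [this]; simp; omega
  | negSucc n =>
    have : Equiv.intEquivNat (Int.negSucc n) = 2 * n + 1 := rfl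
    rw [this]; simp; omega

theorem intEquiv_toNat (z : ℤ) : z.toNat =
    if Equiv.intEquivNat z % 2 = 0 then Equiv.intEquivNat z / 2 else 0 := by
  cases z with
  | ofNat n =>
    have : Equiv.intEquivNat (Int.ofNat n) = 2 * n := rfl
    rw [this, if_pos (by omega)]; simp
  | negSucc n =>
    have : Equiv.intEquivNat (Int.negSucc n) = 2 * n + 1 := rfl
    rw [this, if_neg (by omega)]; simp

theorem intEquiv_neg_toNat (z : ℤ) : (-z).toNat = z.natAbs - z.toNat := by omega

/-- Codes of rationals. -/
def rawS (k : ℕ) : Prop :=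
  0 < k.unpair.2 ∧ ¬ ∃ t < k.unpair.2 + 1, (1 < t ∧
    ((k.unpair.1 + 1) / 2) % t = 0 ∧ k.unpair.2 % t = 0)

theorem rawS_iff (k : ℕ) : rawS k ↔ ∃ q, rawQ q = k := by
  have key : ∀ (a d : ℕ), 0 < d → ((¬ ∃ t < d + 1, (1 < t ∧ a % t = 0 ∧ d % t = 0)) ↔
      a.Coprime d) := by
    intro a d hd
    constructor
    · intro h
      by_contra hc
      apply h
      refine ⟨Nat.gcd a d, ?_, ?_, ?_, ?_⟩
      · exact Nat.lt_succ_of_le (Nat.le_of_dvd hd (Nat.gcd_dvd_right _ _))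
      · have : Nat.gcd a d ≠ 0 := fun h0 => by
          have := Nat.gcd_dvd_right a d
          rw [h0, zero_dvd_iff] at this; omega
        have : Nat.gcd a d ≠ 1 := hc
        omega
      · exact Nat.mod_eq_zero_of_dvd (Nat.gcd_dvd_left _ _)
      · exact Nat.mod_eq_zero_of_dvd (Nat.gcd_dvd_right _ _)
    · rintro h ⟨t, _, h1, h2, h3⟩
      have := Nat.dvd_gcd (Nat.dvd_of_mod_eq_zero h2) (Nat.dvd_of_mod_eq_zero h3)
      rw [h] at this
      have := Nat.le_of_dvd one_pos this
      omega
  unfold rawS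
  constructor
  · rintro ⟨h1, h2⟩
    rw [key _ _ h1] at h2
    refine ⟨⟨Equiv.intEquivNat.symm k.unpair.1, k.unpair.2, by omega, ?_⟩, ?_⟩
    · rw [intEquiv_natAbs, Equiv.apply_symm_apply]; exact h2
    · rw [rawQ_eq]; simp
  · rintro ⟨q, rfl⟩
    rw [rawQ_eq, Nat.unpair_pair]
    refine ⟨q.den_pos, ?_⟩
    rw [key _ _ q.den_pos]
    simp only [← intEquiv_natAbs]
    exact q.reduced

theorem rawS_primrec : PrimrecPred rawS := by
  have h1 : PrimrecPred (fun k : ℕ => 0 < k.unpair.2) :=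
    Primrec.nat_lt.comp (Primrec.const 0) (Primrec.snd.comp Primrec.unpair)
  have hR : PrimrecRel (fun (t k : ℕ) => (1 < t ∧
    ((k.unpair.1 + 1) / 2) % t = 0 ∧ k.unpair.2 % t = 0)) := by
    have hu1 : Primrec (fun p : ℕ × ℕ => p.2.unpair.1) :=
      Primrec.fst.comp (Primrec.unpair.comp Primrec.snd)
    have hu2 : Primrec (fun p : ℕ × ℕ => p.2.unpair.2) :=
      Primrec.snd.comp (Primrec.unpair.comp Primrec.snd)
    have a1 : PrimrecPred (fun p : ℕ × ℕ => 1 < p.1) :=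
      Primrec.nat_lt.comp (Primrec.const 1) Primrec.fst
    have a2 : PrimrecPred (fun p : ℕ × ℕ => ((p.2.unpair.1 + 1) / 2) % p.1 = 0) :=
      Primrec.eq.comp (Primrec.nat_mod.comp (Primrec.nat_div.comp (Primrec.succ.comp hu1)
        (Primrec.const 2)) Primrec.fst) (Primrec.const 0)
    have a3 : PrimrecPred (fun p : ℕ × ℕ => p.2.unpair.2 % p.1 = 0) :=
      Primrec.eq.comp (Primrec.nat_mod.comp hu2 Primrec.fst) (Primrec.const 0)
    exact a1.and (a2.and a3)
  exact h1.and ((hR.exists_lt.comp (Primrec.succ.comp (Primrec.snd.comp Primrec.unpair))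
    Primrec.id).not)

theorem rawS_next (x : ℕ) : ∃ m, x ≤ m ∧ rawS m := by
  have hinf : (Set.range rawQ).Infinite :=
    Set.infinite_range_of_injective (@Encodable.encode_injective ℚ Rat.instEncodable)
  obtain ⟨m, ⟨q, hq⟩, hm⟩ := hinf.exists_gt x
  exact ⟨m, hm.le, (rawS_iff m).2 ⟨q, hq⟩⟩

open Classical in
noncomputable def rawNext (x : ℕ) : ℕ := Nat.find (rawS_next x)

theorem rawNext_computable : Computable rawNext := by
  classical
  have : PrimrecPred (fun p : ℕ × ℕ => p.1 ≤ p.2 ∧ rawS p.2) :=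
    (Primrec.nat_le.comp Primrec.fst Primrec.snd).and (rawS_primrec.comp Primrec.snd)
  exact (Computable.find (P := fun x m => x ≤ m ∧ rawS m) this.computablePred rawS_next).of_eq
    (fun n => by unfold rawNext; congr)

noncomputable def rawNth (n : ℕ) : ℕ :=
  Nat.rec (rawNext 0) (fun _ ih => rawNext (ih + 1)) n

theorem rawNth_computable : Computable rawNth := by
  have : Computable₂ (fun (_ : ℕ) (p : ℕ × ℕ) => rawNext (p.2 + 1)) :=
    rawNext_computable.comp (Computable.succ.comp (Computable.snd.comp Computable.snd))
  exact Computable.nat_rec Computable.id (Computable.const (rawNext 0)) this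

theorem rawNext_spec (x m : ℕ) (h1 : x ≤ m) (h2 : rawS m) (h3 : ∀ y, x ≤ y → rawS y → m ≤ y) :
    rawNext x = m := by
  classical
  unfold rawNext
  apply le_antisymm
  · exact Nat.find_min' _ ⟨h1, h2⟩
  · have := Nat.find_spec (rawS_next x)
    exact h3 _ this.1 this.2

theorem rawNth_subtype (s : Set ℕ) [DecidablePred (· ∈ s)] [Infinite s]
    (hs : ∀ k, k ∈ s ↔ rawS k) (n : ℕ) : rawNth n = (Nat.Subtype.ofNat s n : ℕ) := by
  induction n with
  | zero =>
    apply rawNext_spec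
    · exact Nat.zero_le _
    · exact (hs _).1 (Subtype.property _)
    · intro y _ hy
      exact (bot_le : (⊥ : s) ≤ ⟨y, (hs y).2 hy⟩)
  | succ n ih =>
    change rawNext (rawNth n + 1) = _
    rw [ih]
    apply rawNext_spec
    · exact Nat.Subtype.lt_succ_self (Nat.Subtype.ofNat s n)
    · exact (hs _).1 (Subtype.property _)
    · intro y hy1 hy
      exact Nat.Subtype.succ_le_of_lt (x := ⟨y, (hs y).2 hy⟩) (y := Nat.Subtype.ofNat s n) hy1

theorem rawNth_ofNat (n : ℕ) : rawNth n = rawQ (Denumerable.ofNat ℚ n) := by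
  letI := @Encodable.decidableRangeEncode ℚ Rat.instEncodable
  letI : Infinite (Set.range (@Encodable.encode ℚ Rat.instEncodable)) :=
    Infinite.of_injective _ (Equiv.ofInjective _
      (@Encodable.encode_injective ℚ Rat.instEncodable)).injective
  rw [rawNth_subtype (Set.range (@Encodable.encode ℚ Rat.instEncodable))
    (fun k => (rawS_iff k).symm)]
  have h : Denumerable.ofNat ℚ n = (@Encodable.equivRangeEncode ℚ Rat.instEncodable).symm
    (Nat.Subtype.ofNat (Set.range (@Encodable.encode ℚ Rat.instEncodable)) n) := by
    rfl
  rw [h]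
  have h2 := (@Encodable.equivRangeEncode ℚ Rat.instEncodable).apply_symm_apply
    (Nat.Subtype.ofNat (Set.range (@Encodable.encode ℚ Rat.instEncodable)) n)
  exact (congrArg Subtype.val h2).symm

theorem rawQ_computable : Computable rawQ := by
  refine (rawNth_computable.comp Computable.encode).of_eq (fun q => ?_)
  rw [rawNth_ofNat, Denumerable.ofNat_encode]

theorem den_computable : Computable (fun q : ℚ => q.den) :=
  (Computable.snd.comp (Computable.unpair.comp rawQ_computable)).of_eq (fun q => by
    rw [rawQ_eq, Nat.unpair_pair])

theorem numcode_computable : Computable (fun q : ℚ => Equiv.intEquivNat q.num) :=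
  (Computable.fst.comp (Computable.unpair.comp rawQ_computable)).of_eq (fun q => by
    rw [rawQ_eq, Nat.unpair_pair])

theorem natAbs_computable : Computable (fun q : ℚ => q.num.natAbs) := by
  have : Primrec (fun n : ℕ => (n + 1) / 2) :=
    Primrec.nat_div.comp Primrec.succ (Primrec.const 2)
  exact (this.to_comp.comp numcode_computable).of_eq (fun q => (intEquiv_natAbs _).symm)

theorem toNat_computable : Computable (fun q : ℚ => q.num.toNat) := by
  have : Primrec (fun n : ℕ => if n % 2 = 0 then n / 2 else 0) :=
    Primrec.ite (Primrec.eq.comp (Primrec.nat_mod.comp Primrec.id (Primrec.const 2))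
      (Primrec.const 0)) (Primrec.nat_div.comp Primrec.id (Primrec.const 2)) (Primrec.const 0)
  exact (this.to_comp.comp numcode_computable).of_eq (fun q => (intEquiv_toNat _).symm)

theorem negToNat_computable : Computable (fun q : ℚ => (-q.num).toNat) :=
  (Primrec.nat_sub.to_comp.comp natAbs_computable toNat_computable).of_eq
    (fun q => (intEquiv_neg_toNat _).symm)

/-- Positive part of the numerator, negative part of the numerator, denominator. -/
def ratT (q : ℚ) : ℕ × ℕ × ℕ := (q.num.toNat, (-q.num).toNat, q.den)

theorem ratT_computable : Computable ratT :=
  Computable.pair toNat_computable (Computable.pair negToNat_computable den_computable)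

abbrev TData := (ℕ × ℕ × ℕ) × (ℕ × ℕ × ℕ) × (ℕ × ℕ × ℕ) × (ℕ × ℕ × ℕ) × (ℕ × ℕ × ℕ) × (ℕ × ℕ × ℕ)

def affN (a b : ℕ × ℕ × ℕ) (x : ℕ × ℕ) : ℕ × ℕ :=
  ((a.1 * x.1 * b.2.2 + b.1 * x.2 * a.2.2) - (a.2.1 * x.1 * b.2.2 + b.2.1 * x.2 * a.2.2),
    a.2.2 * x.2 * b.2.2)

def stepN (D : TData) (x : ℕ × ℕ) : ℕ × ℕ :=
  if x.1 * D.2.2.2.2.1.2.2 < D.2.2.2.2.1.1 * x.2 then affN D.1 D.2.1 x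
  else affN D.2.2.1 D.2.2.2.1 x

def startN (D : TData) : ℕ × ℕ := (D.2.2.2.2.2.1, D.2.2.2.2.2.2.2)

def slopeN (a : ℕ × ℕ × ℕ) : ℕ := (a.1 + a.2.1) * a.2.2

def boundN (D : TData) : ℕ :=
  2 * (D.2.1.2.2 * D.2.2.2.1.2.2 * D.2.2.2.2.2.2.2 *
    ((slopeN D.1 * slopeN D.2.2.1) * (slopeN D.1 * slopeN D.2.2.1) *
      (slopeN D.1 * slopeN D.2.2.1)))

def hitN (t : ℕ) (D : TData) : Prop :=
  ((stepN D)^[t + 1] (startN D)).1 * (startN D).2 =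
    (startN D).1 * ((stepN D)^[t + 1] (startN D)).2

theorem affN_primrec {α : Type} [Primcodable α] {a b : α → ℕ × ℕ × ℕ} {x : α → ℕ × ℕ}
    (ha : Primrec a) (hb : Primrec b) (hx : Primrec x) :
    Primrec (fun z => affN (a z) (b z) (x z)) := by
  have a1 := Primrec.fst.comp ha
  have a2 := Primrec.fst.comp (Primrec.snd.comp ha)
  have a3 := Primrec.snd.comp (Primrec.snd.comp ha)
  have b1 := Primrec.fst.comp hb
  have b2 := Primrec.fst.comp (Primrec.snd.comp hb)
  have b3 := Primrec.snd.comp (Primrec.snd.comp hb)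
  have x1 := Primrec.fst.comp hx
  have x2 := Primrec.snd.comp hx
  have M : ∀ {u v : α → ℕ}, Primrec u → Primrec v → Primrec (fun z => u z * v z) :=
    fun hu hv => Primrec.nat_mul.comp hu hv
  have A : ∀ {u v : α → ℕ}, Primrec u → Primrec v → Primrec (fun z => u z + v z) :=
    fun hu hv => Primrec.nat_add.comp hu hv
  have S : ∀ {u v : α → ℕ}, Primrec u → Primrec v → Primrec (fun z => u z - v z) :=
    fun hu hv => Primrec.nat_sub.comp hu hv
  exact Primrec.pair (S (A (M (M a1 x1) b3) (M (M b1 x2) a3)) (A (M (M a2 x1) b3) (M (M b2 x2) a3)))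
    (M (M a3 x2) b3)

theorem stepN_primrec : Primrec₂ stepN := by
  have D1 : Primrec (fun p : TData × (ℕ × ℕ) => p.1.1) := Primrec.fst.comp Primrec.fst
  have T1 : Primrec (fun p : TData × (ℕ × ℕ) => p.1.2) := Primrec.snd.comp Primrec.fst
  have D2 : Primrec (fun p : TData × (ℕ × ℕ) => p.1.2.1) := Primrec.fst.comp T1
  have T2 : Primrec (fun p : TData × (ℕ × ℕ) => p.1.2.2) := Primrec.snd.comp T1
  have D3 : Primrec (fun p : TData × (ℕ × ℕ) => p.1.2.2.1) := Primrec.fst.comp T2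
  have T3 : Primrec (fun p : TData × (ℕ × ℕ) => p.1.2.2.2) := Primrec.snd.comp T2
  have D4 : Primrec (fun p : TData × (ℕ × ℕ) => p.1.2.2.2.1) := Primrec.fst.comp T3
  have T4 : Primrec (fun p : TData × (ℕ × ℕ) => p.1.2.2.2.2) := Primrec.snd.comp T3
  have D5 : Primrec (fun p : TData × (ℕ × ℕ) => p.1.2.2.2.2.1) := Primrec.fst.comp T4
  have X : Primrec (fun p : TData × (ℕ × ℕ) => p.2) := Primrec.snd
  have hc : PrimrecPred (fun p : TData × (ℕ × ℕ) =>
      p.2.1 * p.1.2.2.2.2.1.2.2 < p.1.2.2.2.2.1.1 * p.2.2) :=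
    Primrec.nat_lt.comp
      (Primrec.nat_mul.comp (Primrec.fst.comp X) (Primrec.snd.comp (Primrec.snd.comp D5)))
      (Primrec.nat_mul.comp (Primrec.fst.comp D5) (Primrec.snd.comp X))
  exact Primrec.ite hc (affN_primrec D1 D2 X) (affN_primrec D3 D4 X)

theorem startN_primrec : Primrec startN := by
  have T1 : Primrec (fun p : TData => p.2) := Primrec.snd
  have T2 : Primrec (fun p : TData => p.2.2) := Primrec.snd.comp T1
  have T3 : Primrec (fun p : TData => p.2.2.2) := Primrec.snd.comp T2
  have T4 : Primrec (fun p : TData => p.2.2.2.2) := Primrec.snd.comp T3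
  have T5 : Primrec (fun p : TData => p.2.2.2.2.2) := Primrec.snd.comp T4
  exact Primrec.pair (Primrec.fst.comp T5) (Primrec.snd.comp (Primrec.snd.comp T5))

theorem slopeN_primrec : Primrec slopeN :=
  Primrec.nat_mul.comp (Primrec.nat_add.comp Primrec.fst (Primrec.fst.comp Primrec.snd))
    (Primrec.snd.comp Primrec.snd)

theorem boundN_primrec : Primrec boundN := by
  have D1 : Primrec (fun p : TData => p.1) := Primrec.fst
  have T1 : Primrec (fun p : TData => p.2) := Primrec.snd
  have D2 : Primrec (fun p : TData => p.2.1) := Primrec.fst.comp T1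
  have T2 : Primrec (fun p : TData => p.2.2) := Primrec.snd.comp T1
  have D3 : Primrec (fun p : TData => p.2.2.1) := Primrec.fst.comp T2
  have T3 : Primrec (fun p : TData => p.2.2.2) := Primrec.snd.comp T2
  have D4 : Primrec (fun p : TData => p.2.2.2.1) := Primrec.fst.comp T3
  have T4 : Primrec (fun p : TData => p.2.2.2.2) := Primrec.snd.comp T3
  have T5 : Primrec (fun p : TData => p.2.2.2.2.2) := Primrec.snd.comp T4
  have M : ∀ {u v : TData → ℕ}, Primrec u → Primrec v → Primrec (fun z => u z * v z) :=
    fun hu hv => Primrec.nat_mul.comp hu hv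
  have s1 := slopeN_primrec.comp D1
  have s3 := slopeN_primrec.comp D3
  have E := M s1 s3
  have e2 := Primrec.snd.comp (Primrec.snd.comp D2)
  have e4 := Primrec.snd.comp (Primrec.snd.comp D4)
  have e6 := Primrec.snd.comp (Primrec.snd.comp T5)
  exact M (Primrec.const 2) (M (M (M e2 e4) e6) (M (M E E) E))

theorem hitN_primrec : PrimrecRel hitN := by
  have it : Primrec (fun p : ℕ × TData => (stepN p.2)^[p.1 + 1] (startN p.2)) :=
    Primrec.nat_iterate (Primrec.succ.comp Primrec.fst) (startN_primrec.comp Primrec.snd)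
      (stepN_primrec.comp (Primrec.snd.comp Primrec.fst) Primrec.snd)
  have st : Primrec (fun p : ℕ × TData => startN p.2) := startN_primrec.comp Primrec.snd
  exact Primrec.eq.comp (Primrec.nat_mul.comp (Primrec.fst.comp it) (Primrec.snd.comp st))
    (Primrec.nat_mul.comp (Primrec.fst.comp st) (Primrec.snd.comp it))

def searchN (D : TData) : Prop := ∃ t ∈ List.range (boundN D), hitN t D

theorem searchN_primrec : PrimrecPred searchN :=
  hitN_primrec.exists_mem_list.comp (Primrec.list_range.comp boundN_primrec) Primrec.id

def dataT (z : ℚ × ℚ × ℚ × ℚ × ℚ × ℚ) : TData :=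
  (ratT z.1, ratT z.2.1, ratT z.2.2.1, ratT z.2.2.2.1, ratT z.2.2.2.2.1, ratT z.2.2.2.2.2)

theorem dataT_computable : Computable dataT := by
  have D1 : Computable (fun p : ℚ × ℚ × ℚ × ℚ × ℚ × ℚ => p.1) := Computable.fst
  have T1 : Computable (fun p : ℚ × ℚ × ℚ × ℚ × ℚ × ℚ => p.2) := Computable.snd
  have T2 : Computable (fun p : ℚ × ℚ × ℚ × ℚ × ℚ × ℚ => p.2.2) := Computable.snd.comp T1
  have T3 : Computable (fun p : ℚ × ℚ × ℚ × ℚ × ℚ × ℚ => p.2.2.2) := Computable.snd.comp T2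
  have T4 : Computable (fun p : ℚ × ℚ × ℚ × ℚ × ℚ × ℚ => p.2.2.2.2) := Computable.snd.comp T3
  have T5 : Computable (fun p : ℚ × ℚ × ℚ × ℚ × ℚ × ℚ => p.2.2.2.2.2) := Computable.snd.comp T4
  exact (ratT_computable.comp D1).pair ((ratT_computable.comp (Computable.fst.comp T1)).pair
    ((ratT_computable.comp (Computable.fst.comp T2)).pair
    ((ratT_computable.comp (Computable.fst.comp T3)).pair
    ((ratT_computable.comp (Computable.fst.comp T4)).pair (ratT_computable.comp T5)))))

theorem ratT_num (q : ℚ) : (q.num : ℚ) = (q.num.toNat : ℚ) - ((-q.num).toNat : ℚ) := by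
  have : q.num = (q.num.toNat : ℤ) - ((-q.num).toNat : ℤ) := by omega
  exact_mod_cast congrArg (Int.cast : ℤ → ℚ) this

theorem ratT_val (q : ℚ) : q = ((ratT q).1 - (ratT q).2.1 : ℚ) / (ratT q).2.2 := by
  conv_lhs => rw [← Rat.num_div_den q]
  rw [ratT_num]
  rfl

theorem ratT_den_pos (q : ℚ) : 0 < (ratT q).2.2 := q.den_pos

theorem affN_spec (a b y : ℚ) (x : ℕ × ℕ) (hx : 0 < x.2) (hy : y = (x.1 : ℚ) / x.2)
    (h0 : 0 ≤ a * y + b) :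
    0 < (affN (ratT a) (ratT b) x).2 ∧
    a * y + b = ((affN (ratT a) (ratT b) x).1 : ℚ) / (affN (ratT a) (ratT b) x).2 := by
  have hda := ratT_den_pos a
  have hdb := ratT_den_pos b
  have va := ratT_val a
  have vb := ratT_val b
  set A := ratT a
  set B := ratT b
  have hda' : (0 : ℚ) < A.2.2 := by exact_mod_cast hda
  have hdb' : (0 : ℚ) < B.2.2 := by exact_mod_cast hdb
  have hx' : (0 : ℚ) < x.2 := by exact_mod_cast hx
  have hpos : 0 < A.2.2 * x.2 * B.2.2 := by positivity
  refine ⟨hpos, ?_⟩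
  have e : a * y + b = (((A.1 * x.1 * B.2.2 + B.1 * x.2 * A.2.2 : ℕ) : ℚ) -
      ((A.2.1 * x.1 * B.2.2 + B.2.1 * x.2 * A.2.2 : ℕ) : ℚ)) /
      ((A.2.2 * x.2 * B.2.2 : ℕ) : ℚ) := by
    rw [va, vb, hy]; push_cast; field_simp; ring
  have hpos' : (0 : ℚ) < ((A.2.2 * x.2 * B.2.2 : ℕ) : ℚ) := by exact_mod_cast hpos
  have hle : A.2.1 * x.1 * B.2.2 + B.2.1 * x.2 * A.2.2 ≤
      A.1 * x.1 * B.2.2 + B.1 * x.2 * A.2.2 := by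
    rw [e] at h0
    have := mul_nonneg h0 hpos'.le
    rw [div_mul_cancel₀ _ hpos'.ne'] at this
    exact_mod_cast sub_nonneg.1 this
  rw [e]
  unfold affN
  rw [Nat.cast_sub hle]

theorem stepN_spec (a1 b1 a2 b2 c x0 y : ℚ) (hc0 : 0 < c) (hc1 : c < 1)
    (hmaps : ∀ x ∈ Set.Ico (0 : ℚ) 1, pam2 a1 b1 a2 b2 c x ∈ Set.Ico (0 : ℚ) 1)
    (hyI : y ∈ Set.Ico (0 : ℚ) 1)
    (x : ℕ × ℕ) (hx : 0 < x.2) (hy : y = (x.1 : ℚ) / x.2) :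
    0 < (stepN (dataT (a1, b1, a2, b2, c, x0)) x).2 ∧
    pam2 a1 b1 a2 b2 c y = ((stepN (dataT (a1, b1, a2, b2, c, x0)) x).1 : ℚ) /
      (stepN (dataT (a1, b1, a2, b2, c, x0)) x).2 := by
  have hm := (hmaps y hyI).1
  have hx' : (0 : ℚ) < x.2 := by exact_mod_cast hx
  have hcd : (0 : ℚ) < c.den := by exact_mod_cast c.den_pos
  have hcnum : 0 < c.num := Rat.num_pos.2 hc0
  have hcv : c = (c.num.toNat : ℚ) / c.den := by
    have : (c.num : ℚ) = (c.num.toNat : ℚ) := by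
      have : c.num = (c.num.toNat : ℤ) := by omega
      exact_mod_cast congrArg (Int.cast : ℤ → ℚ) this
    rw [← this, Rat.num_div_den]
  have hiff : x.1 * c.den < c.num.toNat * x.2 ↔ y < c := by
    rw [hy]
    conv_rhs => rw [hcv]
    rw [div_lt_div_iff₀ hx' hcd]
    exact_mod_cast Iff.rfl
  have hst : stepN (dataT (a1, b1, a2, b2, c, x0)) x =
      if x.1 * c.den < c.num.toNat * x.2 then affN (ratT a1) (ratT b1) x
      else affN (ratT a2) (ratT b2) x := rfl
  rw [hst]
  by_cases h : y < c
  · rw [if_pos (hiff.2 h)]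
    rw [pam_left _ _ _ _ _ _ hyI.1 h] at hm ⊢
    exact affN_spec a1 b1 y x hx hy hm
  · rw [if_neg (fun h' => h (hiff.1 h'))]
    rw [pam_right _ _ _ _ _ _ (not_lt.1 h) hyI.2] at hm ⊢
    exact affN_spec a2 b2 y x hx hy hm

theorem hitN_iff (a1 b1 a2 b2 c x0 : ℚ) (hc0 : 0 < c) (hc1 : c < 1)
    (hmaps : ∀ x ∈ Set.Ico (0 : ℚ) 1, pam2 a1 b1 a2 b2 c x ∈ Set.Ico (0 : ℚ) 1)
    (hx0 : x0 ∈ Set.Ico (0 : ℚ) 1) (t : ℕ) :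
    hitN t (dataT (a1, b1, a2, b2, c, x0)) ↔ (pam2 a1 b1 a2 b2 c)^[t + 1] x0 = x0 := by
  set D := dataT (a1, b1, a2, b2, c, x0) with hD
  have hs : startN D = (x0.num.toNat, x0.den) := rfl
  have hx0d : 0 < (startN D).2 := x0.den_pos
  have hx0v : x0 = ((startN D).1 : ℚ) / (startN D).2 := by
    have h0 : 0 ≤ x0.num := Rat.num_nonneg.2 hx0.1
    have : (x0.num : ℚ) = (x0.num.toNat : ℚ) := by
      have : x0.num = (x0.num.toNat : ℤ) := by omega
      exact_mod_cast congrArg (Int.cast : ℤ → ℚ) this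
    rw [hs]
    simp only
    rw [← this, Rat.num_div_den]
  have hall : ∀ n, 0 < ((stepN D)^[n] (startN D)).2 ∧ (pam2 a1 b1 a2 b2 c)^[n] x0 =
      (((stepN D)^[n] (startN D)).1 : ℚ) / ((stepN D)^[n] (startN D)).2 := by
    intro n
    induction n with
    | zero => exact ⟨hx0d, hx0v⟩
    | succ n ih =>
      rw [Function.iterate_succ_apply', Function.iterate_succ_apply']
      exact stepN_spec a1 b1 a2 b2 c x0 _ hc0 hc1 hmaps (pam_iter_mem _ hmaps x0 hx0 n) _ ih.1 ih.2
  obtain ⟨h1, h2⟩ := hall (t + 1)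
  rw [h2]
  conv_rhs => rhs; rw [hx0v]
  have h1' : (((stepN D)^[t + 1] (startN D)).2 : ℚ) ≠ 0 := by exact_mod_cast h1.ne'
  have h0' : ((startN D).2 : ℚ) ≠ 0 := by exact_mod_cast hx0d.ne'
  rw [div_eq_div_iff h1' h0']
  unfold hitN
  exact_mod_cast Iff.rfl

theorem boundN_eq (a1 b1 a2 b2 c x0 : ℚ) :
    boundN (dataT (a1, b1, a2, b2, c, x0)) = 2 * pamG a1 b1 a2 b2 x0 := by
  have h : ∀ a : ℚ, slopeN (ratT a) = a.num.natAbs * a.den := by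
    intro a
    have : a.num.toNat + (-a.num).toNat = a.num.natAbs := by omega
    change (a.num.toNat + (-a.num).toNat) * a.den = _
    rw [this]
  have e : boundN (dataT (a1, b1, a2, b2, c, x0)) = 2 * (b1.den * b2.den * x0.den *
    ((slopeN (ratT a1) * slopeN (ratT a2)) * (slopeN (ratT a1) * slopeN (ratT a2)) *
      (slopeN (ratT a1) * slopeN (ratT a2)))) := rfl
  rw [e, h, h]
  unfold pamG pamE
  ring

theorem pam_cancel (f : ℚ → ℚ) (hmaps : ∀ x ∈ Set.Ico (0 : ℚ) 1, f x ∈ Set.Ico (0 : ℚ) 1)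
    (hinj : Set.InjOn f (Set.Ico (0 : ℚ) 1)) (x y : ℚ) (hx : x ∈ Set.Ico (0 : ℚ) 1)
    (hy : y ∈ Set.Ico (0 : ℚ) 1) (n : ℕ) (h : f^[n] x = f^[n] y) : x = y := by
  induction n with
  | zero => exact h
  | succ n ih =>
    rw [Function.iterate_succ_apply', Function.iterate_succ_apply'] at h
    exact ih (hinj (pam_iter_mem f hmaps x hx n) (pam_iter_mem f hmaps y hy n) h)

/-- The periodic orbit problem is decidable for injective two-interval PAM. -/
theorem pam_periodic_orbit_decidable :
    ∃ F : ℚ × ℚ × ℚ × ℚ × ℚ × ℚ → Bool, Computable F ∧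
      ∀ a1 b1 a2 b2 c x0 : ℚ,
        0 < c → c < 1 →
        (∀ x ∈ Set.Ico (0 : ℚ) 1, pam2 a1 b1 a2 b2 c x ∈ Set.Ico (0 : ℚ) 1) →
        Set.InjOn (pam2 a1 b1 a2 b2 c) (Set.Ico (0 : ℚ) 1) →
        x0 ∈ Set.Ico (0 : ℚ) 1 →
        (F (a1, b1, a2, b2, c, x0) = true ↔
          ∃ n m : ℕ, n < m ∧ (pam2 a1 b1 a2 b2 c)^[n] x0 = (pam2 a1 b1 a2 b2 c)^[m] x0) := by
  classical
  refine ⟨fun z => decide (searchN (dataT z)), ?_, ?_⟩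
  · obtain ⟨_, h⟩ := searchN_primrec
    exact (h.to_comp.comp dataT_computable).of_eq (fun z => by congr)
  · intro a1 b1 a2 b2 c x0 hc0 hc1 hmaps hinj hx0
    rw [decide_eq_true_iff]
    unfold searchN
    constructor
    · rintro ⟨t, _, h⟩
      rw [hitN_iff a1 b1 a2 b2 c x0 hc0 hc1 hmaps hx0] at h
      exact ⟨0, t + 1, Nat.succ_pos t, h.symm⟩
    · rintro ⟨n, m, hnm, h⟩
      obtain ⟨k, rfl⟩ := Nat.exists_eq_add_of_lt hnm
      have hk : (pam2 a1 b1 a2 b2 c)^[k + 1] x0 = x0 := by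
        rw [add_assoc, Function.iterate_add_apply] at h
        exact (pam_cancel _ hmaps hinj _ _ hx0 (pam_iter_mem _ hmaps x0 hx0 (k + 1)) n h).symm
      obtain ⟨s, hs, hs'⟩ := pam_period_bound a1 b1 a2 b2 c x0 hc0 hc1 hmaps hinj hx0 (k + 1)
        (Nat.succ_pos k) hk
      refine ⟨s, ?_, ?_⟩
      · rw [List.mem_range, boundN_eq]; exact hs
      · rw [hitN_iff a1 b1 a2 b2 c x0 hc0 hc1 hmaps hx0]; exact hs'
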